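/- There is a universal constant c > 0 such that for every n ≥ 2 there exists T₀ with the following property: for every T ≥ T₀ the mini-max regret of the hypercube feedback graph Q_n on N = 2^n vertices satisfies R*_{Q_n}(T) ≤ c·((N/n)·log n)^{1/3}·T^{2/3}. -/

import Mathlib

open scoped BigOperators

/-- A policy maps the chronological history of (arm, feedback) pairs to a
probability distribution over arms.  The feedback after playing arm `a` is
recorded as a function `V → Option ℝ`, giving the observed loss on the
out-neighbors of `a` and `none` elsewhere. -/
def Policy (V : Type) : Type :=
  List (V × (V → Option ℝ)) → PMF V

/-- The feedback revealed when arm `a` is played against the loss vector `ℓ`: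
exactly the values `ℓ j` for out-neighbors `j` of `a`. -/
def feedbackOf {V : Type} (E : V → V → Bool) (ℓ : V → ℝ) (a : V) : V → Option ℝ :=
  fun j => if E a j then some (ℓ j) else none

/-- The chronological history produced by playing the arm sequence `as`
against the loss sequence `ℓ`. -/
def hist {V : Type} (E : V → V → Bool) (ℓ : ℕ → V → ℝ) (as : List V) :
    List (V × (V → Option ℝ)) :=
  (List.range as.length).zipWith (fun t a => (a, feedbackOf E (ℓ t) a)) as

/-- Probability that the policy `π` plays exactly the arm sequence `as`
during the first `T` rounds. -/
noncomputable def seqProb {V : Type} [Fintype V] (π : Policy V) (E : V → V → Bool)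
    (ℓ : ℕ → V → ℝ) (T : ℕ) (as : Fin T → V) : ℝ :=
  ∏ t : Fin T, (π (hist E ℓ ((List.ofFn as).take t.val)) (as t)).toReal

/-- Expected cumulative loss of the policy `π` over `T` rounds. -/
noncomputable def expectedLoss {V : Type} [Fintype V] (π : Policy V) (E : V → V → Bool)
    (ℓ : ℕ → V → ℝ) (T : ℕ) : ℝ :=
  ∑ as : Fin T → V, seqProb π E ℓ T as * ∑ t : Fin T, ℓ t.val (as t)

/-- Regret of the policy `π` with respect to the fixed arm `a`. -/
noncomputable def regretTo {V : Type} [Fintype V] (π : Policy V) (E : V → V → Bool)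
    (ℓ : ℕ → V → ℝ) (T : ℕ) (a : V) : ℝ :=
  expectedLoss π E ℓ T - ∑ t : Fin T, ℓ t.val a

/-- Regret of the policy `π` with respect to the best fixed arm. -/
noncomputable def regret {V : Type} [Fintype V] (π : Policy V) (E : V → V → Bool)
    (ℓ : ℕ → V → ℝ) (T : ℕ) : ℝ :=
  expectedLoss π E ℓ T - ⨅ a : V, ∑ t : Fin T, ℓ t.val a

/-- A loss sequence taking values in `[0,1]`. -/
def ValidLoss {V : Type} (ℓ : ℕ → V → ℝ) : Prop :=
  ∀ t v, 0 ≤ ℓ t v ∧ ℓ t v ≤ 1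

/-- The mini-max regret of the feedback graph `E` on `V` at horizon `T`. -/
noncomputable def minimaxRegret (V : Type) [Fintype V] (E : V → V → Bool) (T : ℕ) : ℝ :=
  ⨅ π : Policy V, ⨆ ℓ : {ℓ : ℕ → V → ℝ // ValidLoss ℓ}, regret π E ℓ.1 T

/-- A vertex is observable if it has an in-neighbor. -/
def ObservableVertex {V : Type} (E : V → V → Bool) (v : V) : Prop :=
  ∃ u, E u v

/-- A vertex is strongly observable if it has a self-loop or is observed by
all other vertices. -/
def StronglyObservableVertex {V : Type} (E : V → V → Bool) (v : V) : Prop :=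
  E v v ∨ ∀ u, u ≠ v → E u v

/-- A graph is observable if every vertex is observable. -/
def Observable {V : Type} (E : V → V → Bool) : Prop :=
  ∀ v, ObservableVertex E v

/-- A graph is strongly observable if every vertex is strongly observable. -/
def StronglyObservable {V : Type} (E : V → V → Bool) : Prop :=
  ∀ v, StronglyObservableVertex E v

/-- A graph is weakly observable if it is observable but not strongly
observable. -/
def WeaklyObservable {V : Type} (E : V → V → Bool) : Prop :=
  Observable E ∧ ¬ StronglyObservable E

theorem sq_sqrt_sub_sqrt_le_klTerm {a b : ℝ} (ha : 0 < a) (hb : 0 < b) :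
    (√a - √b) ^ 2 ≤ a * (Real.log a - Real.log b) - a + b := by
  have hsa := Real.sqrt_pos.2 ha
  have hsb := Real.sqrt_pos.2 hb
  have h := Real.log_le_sub_one_of_pos (div_pos hsb hsa)
  rw [Real.log_div hsb.ne' hsa.ne', Real.log_sqrt hb.le, Real.log_sqrt ha.le] at h
  have h2 : a * (√b / √a) = √a * √b := by
    field_simp
    rw [Real.sq_sqrt ha.le]
  have h3 := mul_le_mul_of_nonneg_left h ha.le
  nlinarith [Real.sq_sqrt ha.le, Real.sq_sqrt hb.le]

/-- Pinsker's inequality, with a suboptimal constant, for positive vectors of equal mass. -/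
theorem sq_sum_abs_sub_le_kl {ι : Type*} (s : Finset ι) (a b : ι → ℝ)
    (ha : ∀ i ∈ s, 0 < a i) (hb : ∀ i ∈ s, 0 < b i)
    (hab : ∑ i ∈ s, a i = ∑ i ∈ s, b i) (hM : ∑ i ∈ s, a i ≤ 2) :
    (∑ i ∈ s, |a i - b i|) ^ 2 ≤ 8 * ∑ i ∈ s, a i * (Real.log (a i) - Real.log (b i)) := by
  have h1 : ∑ i ∈ s, (√(a i) - √(b i)) ^ 2 ≤
      ∑ i ∈ s, a i * (Real.log (a i) - Real.log (b i)) := by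
    calc _ ≤ ∑ i ∈ s, (a i * (Real.log (a i) - Real.log (b i)) - a i + b i) :=
          Finset.sum_le_sum fun i hi => sq_sqrt_sub_sqrt_le_klTerm (ha i hi) (hb i hi)
      _ = _ := by rw [Finset.sum_add_distrib, Finset.sum_sub_distrib, hab]; ring
  have h2 : ∑ i ∈ s, (√(a i) + √(b i)) ^ 2 ≤ 8 := by
    calc _ ≤ ∑ i ∈ s, (2 * a i + 2 * b i) := by
          refine Finset.sum_le_sum fun i hi => ?_
          nlinarith [Real.sq_sqrt (ha i hi).le, Real.sq_sqrt (hb i hi).le,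
            sq_nonneg (√(a i) - √(b i))]
      _ = 2 * ∑ i ∈ s, a i + 2 * ∑ i ∈ s, b i := by
          rw [Finset.sum_add_distrib, Finset.mul_sum, Finset.mul_sum]
      _ ≤ 8 := by linarith
  have h3 : ∑ i ∈ s, |a i - b i| = ∑ i ∈ s, |√(a i) - √(b i)| * (√(a i) + √(b i)) := by
    refine Finset.sum_congr rfl fun i hi => ?_
    have hs : 0 ≤ √(a i) + √(b i) := by positivity
    have hd : a i - b i = (√(a i) - √(b i)) * (√(a i) + √(b i)) := by
      nlinarith [Real.sq_sqrt (ha i hi).le, Real.sq_sqrt (hb i hi).le]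
    rw [hd, abs_mul, abs_of_nonneg hs]
  have h4 := Finset.sum_mul_sq_le_sq_mul_sq s (fun i => |√(a i) - √(b i)|)
    (fun i => √(a i) + √(b i))
  simp only [sq_abs] at h4
  rw [h3]
  have h5 : 0 ≤ ∑ i ∈ s, (√(a i) - √(b i)) ^ 2 := Finset.sum_nonneg fun i _ => sq_nonneg _
  nlinarith

/-- The perspective of the shifted entropy `3 log r + ∑ i ∈ s, -(p i + 1 / r) log (p i + 1 / r)`,
evaluated at the (unnormalised) vector `x` restricted to the block `s`. -/
noncomputable def blockEntropy {ι : Type*} (r : ℝ) (s : Finset ι) (x : ι → ℝ) : ℝ :=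
  3 * Real.log r * ∑ i ∈ s, x i +
    ∑ i ∈ s, (x i + (∑ j ∈ s, x j) / r) *
      (Real.log (∑ j ∈ s, x j) - Real.log (x i + (∑ j ∈ s, x j) / r))

/-- The derivative of `blockEntropy r s` at `x` in direction `d`. -/
noncomputable def blockEntropyDeriv {ι : Type*} (r : ℝ) (s : Finset ι) (x d : ι → ℝ) : ℝ :=
  3 * Real.log r * ∑ i ∈ s, d i +
    ∑ i ∈ s, (d i + (∑ j ∈ s, d j) / r) *
      (Real.log (∑ j ∈ s, x j) - Real.log (x i + (∑ j ∈ s, x j) / r))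

theorem hasDerivAt_blockEntropy {ι : Type*} {r : ℝ} (hr : 0 < r) {s : Finset ι} (hs : s.Nonempty)
    {x : ι → ℝ} (d : ι → ℝ) (hx : ∀ i ∈ s, 0 < x i) :
    HasDerivAt (fun t : ℝ => blockEntropy r s (fun i => x i + t * d i))
      (blockEntropyDeriv r s x d) 0 := by
  have hy : 0 < ∑ i ∈ s, x i := Finset.sum_pos hx hs
  have lin : ∀ a b : ℝ, HasDerivAt (fun t : ℝ => a + t * b) b 0 := fun a b => by
    simpa using ((hasDerivAt_id (0 : ℝ)).mul_const b).const_add a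
  set y := ∑ i ∈ s, x i with hydef
  set e := ∑ i ∈ s, d i with hedef
  have hfun : (fun t : ℝ => blockEntropy r s (fun i => x i + t * d i)) = fun t : ℝ =>
      3 * Real.log r * (y + t * e) + ∑ i ∈ s, ((x i + y / r) + t * (d i + e / r)) *
      (Real.log (y + t * e) - Real.log ((x i + y / r) + t * (d i + e / r))) := by
    funext t
    have h1 : ∑ i ∈ s, (x i + t * d i) = y + t * e := by
      rw [Finset.sum_add_distrib, ← Finset.mul_sum]
    have h2 : ∀ i, x i + t * d i + (y + t * e) / r = (x i + y / r) + t * (d i + e / r) := by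
      intro i; ring
    simp only [blockEntropy, h1, h2]
  rw [hfun]
  have hz : ∀ i ∈ s, 0 < x i + y / r := fun i hi => add_pos (hx i hi) (div_pos hy hr)
  have hsum : HasDerivAt (fun t : ℝ => ∑ i ∈ s, ((x i + y / r) + t * (d i + e / r)) *
      (Real.log (y + t * e) - Real.log ((x i + y / r) + t * (d i + e / r))))
      (∑ i ∈ s, ((d i + e / r) * (Real.log y - Real.log (x i + y / r)) +
        (x i + y / r) * (e / y - (d i + e / r) / (x i + y / r)))) 0 := by
    refine HasDerivAt.fun_sum fun i hi => ?_
    have := (lin (x i + y / r) (d i + e / r)).fun_mul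
      (((lin y e).log (by simpa using hy.ne')).fun_sub
        ((lin (x i + y / r) (d i + e / r)).log (by simpa using (hz i hi).ne')))
    simpa using this
  have := (((lin y e).const_mul (3 * Real.log r))).add hsum
  refine this.congr_deriv ?_
  rw [blockEntropyDeriv, ← hydef, ← hedef, Finset.sum_add_distrib]
  have hcancel : ∑ i ∈ s, (x i + y / r) * (e / y - (d i + e / r) / (x i + y / r)) = 0 := by
    have : ∀ i ∈ s, (x i + y / r) * (e / y - (d i + e / r) / (x i + y / r)) =
        x i * (e / y) - d i := by
      intro i hi
      rw [mul_sub, mul_div_cancel₀ _ (hz i hi).ne']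
      field_simp
      ring
    rw [Finset.sum_congr rfl this, Finset.sum_sub_distrib, ← Finset.sum_mul, ← hydef, ← hedef]
    field_simp
    ring
  rw [hcancel, add_zero]

theorem blockEntropy_eq {ι : Type*} {r : ℝ} (hr : 0 < r) {s : Finset ι} (hs : s.Nonempty)
    {x : ι → ℝ} (hx : ∀ i ∈ s, 0 < x i) :
    blockEntropy r s x = (∑ i ∈ s, x i) * (3 * Real.log r -
      ∑ i ∈ s, (x i / (∑ j ∈ s, x j) + 1 / r) * Real.log (x i / (∑ j ∈ s, x j) + 1 / r)) := by
  have hy : 0 < ∑ i ∈ s, x i := Finset.sum_pos hx hs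
  set y := ∑ i ∈ s, x i with hydef
  have : ∀ i ∈ s, (x i + y / r) * (Real.log y - Real.log (x i + y / r)) =
      -(y * ((x i / y + 1 / r) * Real.log (x i / y + 1 / r))) := by
    intro i hi
    have hz : 0 < x i + y / r := add_pos (hx i hi) (div_pos hy hr)
    have hb : x i / y + 1 / r = (x i + y / r) / y := by field_simp
    rw [hb, Real.log_div hz.ne' hy.ne']
    field_simp
    ring
  rw [blockEntropy, ← hydef, Finset.sum_congr rfl this, Finset.sum_neg_distrib, ← Finset.mul_sum]
  ring

theorem shifted_prob_facts {ι : Type*} {r : ℝ} (hr : 2 ≤ r) {s : Finset ι} (hs : s.Nonempty)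
    (hcard : (s.card : ℝ) ≤ r) {x : ι → ℝ} (hx : ∀ i ∈ s, 0 < x i) :
    (∀ i ∈ s, 0 < x i / (∑ j ∈ s, x j) + 1 / r) ∧
    (∀ i ∈ s, |Real.log (x i / (∑ j ∈ s, x j) + 1 / r)| ≤ Real.log r) ∧
    ∑ i ∈ s, x i / (∑ j ∈ s, x j) = 1 ∧
    ∑ i ∈ s, (x i / (∑ j ∈ s, x j) + 1 / r) = 1 + s.card / r ∧
    ∑ i ∈ s, (x i / (∑ j ∈ s, x j) + 1 / r) ≤ 2 := by
  have hy : 0 < ∑ i ∈ s, x i := Finset.sum_pos hx hs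
  set y := ∑ i ∈ s, x i with hydef
  have hr0 : 0 < r := by linarith
  have h1 : ∀ i ∈ s, 0 < x i / y + 1 / r := fun i hi =>
    add_pos (div_pos (hx i hi) hy) (by positivity)
  have hsum1 : ∑ i ∈ s, x i / y = 1 := by
    rw [← Finset.sum_div, ← hydef, div_self hy.ne']
  have hsum : ∑ i ∈ s, (x i / y + 1 / r) = 1 + s.card / r := by
    rw [Finset.sum_add_distrib, hsum1, Finset.sum_const, nsmul_eq_mul]
    ring
  refine ⟨h1, fun i hi => ?_, hsum1, hsum, ?_⟩
  · rw [abs_le]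
    constructor
    · rw [← Real.log_inv]
      apply Real.log_le_log (by positivity)
      have := div_pos (hx i hi) hy
      rw [one_div]; linarith
    · apply Real.log_le_log (h1 i hi)
      have h2 : x i / y ≤ 1 := by
        rw [div_le_one hy]
        exact Finset.single_le_sum (f := x) (fun j hj => (hx j hj).le) hi
      have h3 : 1 / r ≤ 1 := by rw [div_le_one hr0]; linarith
      linarith
  · rw [hsum]
    have : (s.card : ℝ) / r ≤ 1 := by rw [div_le_one hr0]; exact hcard
    linarith

theorem abs_sum_mul_log_le {ι : Type*} (s : Finset ι) (a b : ι → ℝ) {l : ℝ}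
    (hb : ∀ i ∈ s, |Real.log (b i)| ≤ l) :
    |∑ i ∈ s, a i * Real.log (b i)| ≤ (∑ i ∈ s, |a i|) * l := by
  calc _ ≤ ∑ i ∈ s, |a i * Real.log (b i)| := Finset.abs_sum_le_sum_abs _ _
    _ ≤ ∑ i ∈ s, |a i| * l := by
        refine Finset.sum_le_sum fun i hi => ?_
        rw [abs_mul]
        exact mul_le_mul_of_nonneg_left (hb i hi) (abs_nonneg _)
    _ = _ := by rw [Finset.sum_mul]

theorem blockEntropy_bounds {ι : Type*} {r : ℝ} (hr : 2 ≤ r) {s : Finset ι} (hs : s.Nonempty)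
    (hcard : (s.card : ℝ) ≤ r) {x : ι → ℝ} (hx : ∀ i ∈ s, 0 < x i) :
    (∑ i ∈ s, x i) * Real.log r ≤ blockEntropy r s x ∧
      blockEntropy r s x ≤ 5 * Real.log r * ∑ i ∈ s, x i := by
  have hy : 0 < ∑ i ∈ s, x i := Finset.sum_pos hx hs
  obtain ⟨h1, h2, -, -, h4⟩ := shifted_prob_facts hr hs hcard hx
  rw [blockEntropy_eq (by linarith) hs hx]
  have h5 := abs_sum_mul_log_le s (fun i => x i / (∑ j ∈ s, x j) + 1 / r) _ h2
  have hL : 0 < Real.log r := Real.log_pos (by linarith)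
  have h6 : ∑ i ∈ s, |x i / (∑ j ∈ s, x j) + 1 / r| ≤ 2 := by
    rw [Finset.sum_congr rfl fun i hi => abs_of_pos (h1 i hi)]
    exact h4
  have h7 := abs_le.1 (h5.trans (mul_le_mul_of_nonneg_right h6 hL.le))
  constructor
  · apply mul_le_mul_of_nonneg_left _ hy.le
    linarith [h7.1, h7.2]
  · rw [mul_comm (5 * Real.log r)]
    apply mul_le_mul_of_nonneg_left _ hy.le
    linarith [h7.1, h7.2]

theorem linear_sub_quadratic_le {a b t : ℝ} (hb : 0 < b) :
    a * t - b * t ^ 2 ≤ a ^ 2 / (4 * b) := by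
  rw [le_div_iff₀ (by positivity)]
  nlinarith [sq_nonneg (a - 2 * b * t)]

theorem blockEntropyDeriv_sub {ι : Type*} {r : ℝ} (hr : 0 < r) {s : Finset ι} (hs : s.Nonempty)
    {x x' : ι → ℝ} (hx : ∀ i ∈ s, 0 < x i) (hx' : ∀ i ∈ s, 0 < x' i) :
    blockEntropyDeriv r s x (fun i => x' i - x i) = (∑ i ∈ s, x' i) * (3 * Real.log r -
      ∑ i ∈ s, (x' i / (∑ j ∈ s, x' j) + 1 / r) * Real.log (x i / (∑ j ∈ s, x j) + 1 / r)) -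
      blockEntropy r s x := by
  have hy : 0 < ∑ i ∈ s, x i := Finset.sum_pos hx hs
  have hy' : 0 < ∑ i ∈ s, x' i := Finset.sum_pos hx' hs
  rw [blockEntropyDeriv, blockEntropy, Finset.sum_sub_distrib]
  set y := ∑ i ∈ s, x i with hydef
  set y' := ∑ i ∈ s, x' i with hydef'
  have : ∀ i ∈ s, (x' i - x i + (y' - y) / r) * (Real.log y - Real.log (x i + y / r)) =
      - (y' * ((x' i / y' + 1 / r) * Real.log (x i / y + 1 / r))) -
      (x i + y / r) * (Real.log y - Real.log (x i + y / r)) := by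
    intro i hi
    have hz : 0 < x i + y / r := add_pos (hx i hi) (div_pos hy hr)
    have hb : x i / y + 1 / r = (x i + y / r) / y := by field_simp
    rw [hb, Real.log_div hz.ne' hy.ne']
    field_simp
    ring
  rw [Finset.sum_congr rfl this, Finset.sum_sub_distrib, Finset.sum_neg_distrib,
    ← Finset.mul_sum]
  ring

theorem stability_of_mass_gain {S c y y' u d τ : ℝ} (hy : 0 < y) (hle : y ≤ y')
    (hu : 0 < u) (hS : S ≤ (c * y) * τ) :
    S - (1 / (2 * u)) * d ^ 2 - (y' / (16 * u)) * τ ^ 2 ≤ 32 * c ^ 2 * y * u := by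
  have hy' : 0 < y' := hy.trans_le hle
  have h7 := linear_sub_quadratic_le (a := c * y) (b := y' / (16 * u)) (t := τ) (by positivity)
  have h8 : (c * y) ^ 2 / (4 * (y' / (16 * u))) ≤ 4 * c ^ 2 * y * u := by
    rw [div_le_iff₀ (by positivity)]
    have : 4 * c ^ 2 * y * u * (4 * (y' / (16 * u))) = c ^ 2 * y * y' := by field_simp; ring
    rw [this]
    nlinarith [mul_le_mul_of_nonneg_left hle (by positivity : 0 ≤ c ^ 2 * y)]
  have h9 : 0 ≤ (1 / (2 * u)) * d ^ 2 := by positivity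
  have h10 : 0 ≤ c ^ 2 * y * u := by positivity
  linarith

theorem stability_of_mass_loss {S c y y' u u' τ L : ℝ} (hc : 0 ≤ c) (hy' : 0 < y') (hle : y' ≤ y)
    (hu : 0 < u) (hu' : 0 < u') (hL : 0.69 ≤ L) (huy : u ^ 2 ≤ 5 * L * y)
    (huy' : u' ^ 2 ≤ 5 * L * y) (hmass : (y - y') * L ≤ (u ^ 2 - u' ^ 2) + y' * τ * L)
    (hS : S ≤ c * ((y - y') + y' * τ)) :
    S - (1 / (2 * u)) * (u' - u) ^ 2 - (y' / (16 * u)) * τ ^ 2 ≤ 32 * c ^ 2 * y * u := by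
  have hy : 0 < y := hy'.trans_le hle
  have hL0 : 0 < L := by linarith
  set δ := |u' - u| with hδ
  set q := √(5 * L * y) with hq
  have hq2 : q ^ 2 = 5 * L * y := Real.sq_sqrt (by positivity)
  have hq0 : 0 ≤ q := Real.sqrt_nonneg _
  have huq : u ≤ q := Real.le_sqrt_of_sq_le huy
  have huq' : u' ≤ q := Real.le_sqrt_of_sq_le huy'
  have hδ0 : 0 ≤ δ := abs_nonneg _
  have hYY : u ^ 2 - u' ^ 2 ≤ 2 * q * δ := by
    have h3 : u - u' ≤ δ := by rw [hδ, abs_sub_comm]; exact le_abs_self _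
    calc u ^ 2 - u' ^ 2 = (u + u') * (u - u') := by ring
      _ ≤ (u + u') * δ := mul_le_mul_of_nonneg_left h3 (by positivity)
      _ ≤ 2 * q * δ := mul_le_mul_of_nonneg_right (by linarith) hδ0
  have hmass2 : y - y' ≤ (2 * q / L) * δ + y' * τ := by
    have h2 : (2 * q / L) * δ + y' * τ = (2 * q * δ + y' * τ * L) / L := by field_simp
    rw [h2, le_div_iff₀ hL0]
    linarith
  have h2 : S ≤ (2 * c * q / L) * δ + (2 * c * y') * τ := by
    have h3 := mul_le_mul_of_nonneg_left hmass2 hc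
    have h4 : (2 * c * q / L) * δ = c * ((2 * q / L) * δ) := by ring
    rw [h4]
    linarith
  have h3 := linear_sub_quadratic_le (a := 2 * c * q / L) (b := 1 / (2 * u)) (t := δ)
    (by positivity)
  have h4 := linear_sub_quadratic_le (a := 2 * c * y') (b := y' / (16 * u)) (t := τ)
    (by positivity)
  have h5 : (2 * c * q / L) ^ 2 / (4 * (1 / (2 * u))) ≤ 16 * c ^ 2 * y * u := by
    have h6 : (2 * c * q / L) ^ 2 / (4 * (1 / (2 * u))) = 10 * c ^ 2 * y * u / L := by
      rw [div_pow, mul_pow, hq2]; field_simp; ring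
    rw [h6, div_le_iff₀ hL0]
    have : 0 ≤ c ^ 2 * y * u := by positivity
    nlinarith
  have h7 : (2 * c * y') ^ 2 / (4 * (y' / (16 * u))) ≤ 16 * c ^ 2 * y * u := by
    have h6 : (2 * c * y') ^ 2 / (4 * (y' / (16 * u))) = 16 * c ^ 2 * y' * u := by
      field_simp; ring
    rw [h6]
    apply mul_le_mul_of_nonneg_right _ hu.le
    exact mul_le_mul_of_nonneg_left hle (by positivity)
  have h8 : δ ^ 2 = (u' - u) ^ 2 := sq_abs _
  rw [h8] at h3
  linarith

theorem sum_mul_sub_le_of_mass_gain {ι : Type*} {s : Finset ι} {x x' e : ι → ℝ} {y y' c : ℝ}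
    (hx' : ∀ i ∈ s, 0 < x' i) (hy : 0 < y) (hle : y ≤ y')
    (he0 : ∀ i ∈ s, 0 ≤ e i) (hec : ∀ i ∈ s, e i ≤ c) :
    ∑ i ∈ s, e i * (x i - x' i) ≤ (c * y) * ∑ i ∈ s, |x' i / y' - x i / y| := by
  have hy' : 0 < y' := hy.trans_le hle
  rw [Finset.mul_sum]
  refine Finset.sum_le_sum fun i hi => ?_
  have h2 : x i - x' i ≤ y * |x' i / y' - x i / y| := by
    have h3 : y * (x' i / y') ≤ x' i := by
      calc y * (x' i / y') ≤ y' * (x' i / y') :=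
            mul_le_mul_of_nonneg_right hle (div_pos (hx' i hi) hy').le
        _ = x' i := mul_div_cancel₀ _ hy'.ne'
    have h4 := mul_le_mul_of_nonneg_left (neg_abs_le (x' i / y' - x i / y)) hy.le
    have h5 : y * (x i / y) = x i := mul_div_cancel₀ _ hy.ne'
    linarith
  calc e i * (x i - x' i) ≤ e i * (y * |x' i / y' - x i / y|) :=
        mul_le_mul_of_nonneg_left h2 (he0 i hi)
    _ ≤ c * (y * |x' i / y' - x i / y|) :=
        mul_le_mul_of_nonneg_right (hec i hi) (by positivity)
    _ = _ := by ring

theorem sum_mul_sub_le_of_mass_loss {ι : Type*} {s : Finset ι} {x x' e : ι → ℝ} {y y' c : ℝ}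
    (hx : ∀ i ∈ s, 0 < x i) (hp : ∑ i ∈ s, x i / y = 1) (hy' : 0 < y') (hle : y' ≤ y)
    (he0 : ∀ i ∈ s, 0 ≤ e i) (hec : ∀ i ∈ s, e i ≤ c) :
    ∑ i ∈ s, e i * (x i - x' i) ≤ c * ((y - y') + y' * ∑ i ∈ s, |x' i / y' - x i / y|) := by
  have hy : 0 < y := hy'.trans_le hle
  have h2 : (y - y') + y' * ∑ i ∈ s, |x' i / y' - x i / y| =
      ∑ i ∈ s, ((y - y') * (x i / y) + y' * |x' i / y' - x i / y|) := by
    rw [Finset.sum_add_distrib, ← Finset.mul_sum, ← Finset.mul_sum, hp, mul_one]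
  rw [h2, Finset.mul_sum]
  refine Finset.sum_le_sum fun i hi => ?_
  have hp : 0 < x i / y := div_pos (hx i hi) hy
  have h3 : 0 ≤ (y - y') * (x i / y) + y' * |x' i / y' - x i / y| :=
    add_nonneg (mul_nonneg (by linarith) hp.le) (by positivity)
  have h4 : x i - x' i ≤ (y - y') * (x i / y) + y' * |x' i / y' - x i / y| := by
    have h5 := mul_le_mul_of_nonneg_left (neg_abs_le (x' i / y' - x i / y)) hy'.le
    have h6 : y * (x i / y) = x i := mul_div_cancel₀ _ hy.ne'
    have h7 : y' * (x' i / y') = x' i := mul_div_cancel₀ _ hy'.ne'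
    linarith
  exact (mul_le_mul_of_nonneg_left h4 (he0 i hi)).trans
    (mul_le_mul_of_nonneg_right (hec i hi) h3)

set_option maxHeartbeats 1000000 in
/-- The one-block stability estimate for follow-the-regularised-leader with regulariser
`-√(blockEntropy r s x)`. -/
theorem block_stability {ι : Type*} {r : ℝ} (hr : 2 ≤ r) {s : Finset ι} (hs : s.Nonempty)
    (hcard : (s.card : ℝ) ≤ r) {x x' e : ι → ℝ} (hx : ∀ i ∈ s, 0 < x i) (hx' : ∀ i ∈ s, 0 < x' i)
    {c : ℝ} (hc : 0 ≤ c) (he0 : ∀ i ∈ s, 0 ≤ e i) (hec : ∀ i ∈ s, e i ≤ c) :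
    ∑ i ∈ s, e i * (x i - x' i) + √(blockEntropy r s x') - √(blockEntropy r s x) -
        blockEntropyDeriv r s x (fun i => x' i - x i) / (2 * √(blockEntropy r s x)) ≤
      32 * c ^ 2 * (∑ i ∈ s, x i) * √(blockEntropy r s x) := by
  have hr0 : 0 < r := by linarith
  have hL : 0 < Real.log r := Real.log_pos (by linarith)
  have hL2 : 0.69 ≤ Real.log r :=
    le_trans (by linarith [Real.log_two_gt_d9]) (Real.log_le_log (by norm_num) hr)
  obtain ⟨hb0, hbl, hb1, hbs, hb2⟩ := shifted_prob_facts hr hs hcard hx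
  obtain ⟨ha0, hal, ha1, has, ha2⟩ := shifted_prob_facts hr hs hcard hx'
  obtain ⟨hYl, hYu⟩ := blockEntropy_bounds hr hs hcard hx
  obtain ⟨hYl', hYu'⟩ := blockEntropy_bounds hr hs hcard hx'
  have hYeq := blockEntropy_eq hr0 hs hx
  have hYeq' := blockEntropy_eq hr0 hs hx'
  have hD := blockEntropyDeriv_sub hr0 hs hx hx'
  have hy : 0 < ∑ i ∈ s, x i := Finset.sum_pos hx hs
  have hy' : 0 < ∑ i ∈ s, x' i := Finset.sum_pos hx' hs
  rw [hD]
  set Y := blockEntropy r s x with hY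
  set Y' := blockEntropy r s x' with hY'
  set y := ∑ i ∈ s, x i with hydef
  set y' := ∑ i ∈ s, x' i with hydef'
  set a : ι → ℝ := fun i => x' i / y' + 1 / r with hadef
  set b : ι → ℝ := fun i => x i / y + 1 / r with hbdef
  set k := ∑ i ∈ s, a i * (Real.log (a i) - Real.log (b i)) with hk
  set τ := ∑ i ∈ s, |a i - b i| with hτ
  have hτ0 : 0 ≤ τ := Finset.sum_nonneg fun i _ => abs_nonneg _
  have hpin : τ ^ 2 ≤ 8 * k :=
    sq_sum_abs_sub_le_kl s a b ha0 hb0 (has.trans hbs.symm) ha2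
  have hkexp : k = ∑ i ∈ s, a i * Real.log (a i) - ∑ i ∈ s, a i * Real.log (b i) := by
    rw [hk, ← Finset.sum_sub_distrib]
    exact Finset.sum_congr rfl fun i _ => by ring
  -- the numerator of the Bregman term
  have hDe : y' * (3 * Real.log r - ∑ i ∈ s, a i * Real.log (b i)) - Y = Y' + y' * k - Y := by
    rw [hYeq', hkexp]; ring
  rw [hDe]
  have hent : (3 * Real.log r - ∑ i ∈ s, a i * Real.log (a i)) -
      (3 * Real.log r - ∑ i ∈ s, b i * Real.log (b i)) ≤ τ * Real.log r := by
    have h1 := abs_le.1 (abs_sum_mul_log_le s (fun i => a i - b i) b hbl)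
    have h2 : ∑ i ∈ s, (a i - b i) * Real.log (b i) =
        ∑ i ∈ s, a i * Real.log (b i) - ∑ i ∈ s, b i * Real.log (b i) := by
      rw [← Finset.sum_sub_distrib]
      exact Finset.sum_congr rfl fun i _ => by ring
    rw [h2] at h1
    nlinarith [h1.1]
  have hY0 : 0 < Y := lt_of_lt_of_le (by positivity) hYl
  have hY0' : 0 < Y' := lt_of_lt_of_le (by positivity) hYl'
  have hsY := Real.sqrt_pos.2 hY0
  have hsY' := Real.sqrt_pos.2 hY0'
  have hqY := Real.sq_sqrt hY0.le
  have hqY' := Real.sq_sqrt hY0'.le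
  set u := √Y with hu
  set u' := √Y' with hu'
  have hbreg : u' - u - (Y' + y' * k - Y) / (2 * u) = -((u' - u) ^ 2 + y' * k) / (2 * u) := by
    field_simp
    nlinarith
  have hbreg2 : -((u' - u) ^ 2 + y' * k) / (2 * u) ≤
      -((1 / (2 * u)) * (u' - u) ^ 2) - (y' / (16 * u)) * τ ^ 2 := by
    have h1 : y' * k / (2 * u) ≥ (y' / (16 * u)) * τ ^ 2 := by
      have : y' * k / (2 * u) = (y' / (16 * u)) * (8 * k) := by field_simp; ring
      rw [this]
      exact mul_le_mul_of_nonneg_left hpin (by positivity)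
    have h2 : -((u' - u) ^ 2 + y' * k) / (2 * u) =
        -((1 / (2 * u)) * (u' - u) ^ 2) - y' * k / (2 * u) := by field_simp; ring
    linarith
  have hτ' : τ = ∑ i ∈ s, |x' i / y' - x i / y| :=
    Finset.sum_congr rfl fun i _ => by simp only [hadef, hbdef, add_sub_add_right_eq_sub]
  have hgoal : ∑ i ∈ s, e i * (x i - x' i) -
      (1 / (2 * u)) * (u' - u) ^ 2 - (y' / (16 * u)) * τ ^ 2 ≤ 32 * c ^ 2 * y * u := by
    rcases le_total y y' with hle | hle
    · have h1 : ∑ i ∈ s, e i * (x i - x' i) ≤ (c * y) * τ := by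
        rw [hτ']
        exact sum_mul_sub_le_of_mass_gain hx' hy hle he0 hec
      exact stability_of_mass_gain hy hle hsY h1
    · have h1 : ∑ i ∈ s, e i * (x i - x' i) ≤ c * ((y - y') + y' * τ) := by
        rw [hτ']
        exact sum_mul_sub_le_of_mass_loss hx hb1 hy' hle he0 hec
      set L := Real.log r with hLdef
      set g := 3 * L - ∑ i ∈ s, b i * Real.log (b i) with hg
      set g' := 3 * L - ∑ i ∈ s, a i * Real.log (a i) with hg'
      have hgL : L ≤ g := by
        rw [hYeq] at hYl
        exact le_of_mul_le_mul_left hYl hy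
      have hmass : (y - y') * L ≤ (u ^ 2 - u' ^ 2) + y' * τ * L := by
        have h2 : (y - y') * g = (Y - Y') + y' * (g' - g) := by rw [hYeq, hYeq']; ring
        have h3 : (y - y') * L ≤ (y - y') * g := mul_le_mul_of_nonneg_left hgL (by linarith)
        have h4 := mul_le_mul_of_nonneg_left hent hy'.le
        rw [hqY, hqY']
        linarith
      have hYu2 : Y' ≤ 5 * L * y :=
        hYu'.trans (mul_le_mul_of_nonneg_left hle (by positivity))
      rw [← hqY] at hYu
      rw [← hqY'] at hYu2
      exact stability_of_mass_loss hc hy' hle hsY hsY' hL2 hYu hYu2 hmass h1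
  linarith [hbreg, hbreg2, hgoal]

theorem hist_concat {V : Type} (E : V → V → Bool) (ℓ : ℕ → V → ℝ) (as : List V) (a : V) :
    hist E ℓ (as ++ [a]) = hist E ℓ as ++ [(a, feedbackOf E (ℓ as.length) a)] := by
  rw [hist, hist, List.length_append, List.length_singleton, List.range_succ,
    List.zipWith_append (by simp)]
  rfl

theorem List.ofFn_snoc_eq {V : Type} {T : ℕ} (as : Fin T → V) (a : V) :
    List.ofFn (Fin.snoc as a : Fin (T + 1) → V) = List.ofFn as ++ [a] := by
  rw [List.ofFn_succ', List.concat_eq_append]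
  simp

theorem seqProb_snoc {V : Type} [Fintype V] (π : Policy V) (E : V → V → Bool)
    (ℓ : ℕ → V → ℝ) (T : ℕ) (as : Fin T → V) (a : V) :
    seqProb π E ℓ (T + 1) (Fin.snoc as a) =
      seqProb π E ℓ T as * (π (hist E ℓ (List.ofFn as)) a).toReal := by
  rw [seqProb, seqProb, Fin.prod_univ_castSucc, List.ofFn_snoc_eq]
  congr 1
  · refine Finset.prod_congr rfl fun i _ => ?_
    rw [Fin.snoc_castSucc, List.take_append_of_le_length (by simp [i.2.le])]
    rfl
  · rw [Fin.snoc_last, List.take_append_of_le_length (by simp), List.take_of_length_le (by simp)]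

theorem seqProb_nonneg {V : Type} [Fintype V] (π : Policy V) (E : V → V → Bool)
    (ℓ : ℕ → V → ℝ) (T : ℕ) (as : Fin T → V) : 0 ≤ seqProb π E ℓ T as :=
  Finset.prod_nonneg fun _ _ => ENNReal.toReal_nonneg

theorem sum_seqProb_mul_succ {V : Type} [Fintype V] (π : Policy V) (E : V → V → Bool)
    (ℓ : ℕ → V → ℝ) (T : ℕ) (G : (Fin (T + 1) → V) → ℝ) :
    ∑ as, seqProb π E ℓ (T + 1) as * G as = ∑ as : Fin T → V, seqProb π E ℓ T as *
      ∑ a, (π (hist E ℓ (List.ofFn as)) a).toReal * G (Fin.snoc as a) := by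
  rw [← (Fin.snocEquiv (fun _ : Fin (T + 1) => V)).sum_comp, Fintype.sum_prod_type,
    Finset.sum_comm]
  refine Finset.sum_congr rfl fun as _ => ?_
  rw [Finset.mul_sum]
  refine Finset.sum_congr rfl fun a _ => ?_
  rw [← mul_assoc, ← seqProb_snoc]
  rfl

theorem PMF.sum_toReal_eq_one {V : Type} [Fintype V] (p : PMF V) : ∑ a, (p a).toReal = 1 := by
  rw [← ENNReal.toReal_sum fun a _ => p.apply_ne_top a, ← tsum_fintype (L := .unconditional V),
    p.tsum_coe, ENNReal.toReal_one]

/-- If `Φ` is a nonnegative potential which, in expectation, absorbs the loss of each round up to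
the amount `b t`, then the expected cumulative loss is at most `Φ [] + ∑ t, b t`. -/
theorem expectedLoss_le_of_potential {V : Type} [Fintype V] (π : Policy V) (E : V → V → Bool)
    (ℓ : ℕ → V → ℝ) (Φ : List V → ℝ) (hΦ : ∀ as, 0 ≤ Φ as) (b : ℕ → ℝ)
    (hstep : ∀ as : List V, ∑ a, (π (hist E ℓ as) a).toReal *
      (ℓ as.length a + Φ (as ++ [a])) ≤ Φ as + b as.length) (T : ℕ) :
    expectedLoss π E ℓ T ≤ Φ [] + ∑ t : Fin T, b t := by
  have key : ∀ T : ℕ, ∑ as : Fin T → V, seqProb π E ℓ T as *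
      (∑ t : Fin T, (ℓ t (as t) - b t) + Φ (List.ofFn as)) ≤ Φ [] := by
    intro T
    induction T with
    | zero => simp [seqProb]
    | succ T ih =>
      rw [sum_seqProb_mul_succ]
      refine le_trans (Finset.sum_le_sum fun as _ =>
        mul_le_mul_of_nonneg_left ?_ (seqProb_nonneg π E ℓ T as)) ih
      have h := hstep (List.ofFn as)
      rw [List.length_ofFn] at h
      have h1 := PMF.sum_toReal_eq_one (π (hist E ℓ (List.ofFn as)))
      simp only [Fin.sum_univ_castSucc, Fin.snoc_castSucc, Fin.snoc_last, List.ofFn_snoc_eq,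
        Fin.val_castSucc, Fin.val_last]
      set S := ∑ t : Fin T, (ℓ t (as t) - b t)
      calc _ = ∑ a, ((π (hist E ℓ (List.ofFn as)) a).toReal * (S - b T) +
            (π (hist E ℓ (List.ofFn as)) a).toReal * (ℓ T a + Φ (List.ofFn as ++ [a]))) :=
            Finset.sum_congr rfl fun a _ => by ring
        _ ≤ _ := by
            rw [Finset.sum_add_distrib, ← Finset.sum_mul, h1]
            linarith
  have hone : ∀ T : ℕ, ∑ as : Fin T → V, seqProb π E ℓ T as = 1 := by
    intro T
    induction T with
    | zero => simp [seqProb]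
    | succ T ih =>
      have := sum_seqProb_mul_succ π E ℓ T (fun _ => 1)
      simp only [mul_one, PMF.sum_toReal_eq_one] at this
      rw [this, ih]
  have h2 : ∑ as : Fin T → V, seqProb π E ℓ T as * (∑ t : Fin T, ℓ t (as t)) -
      ∑ t : Fin T, b t ≤ ∑ as : Fin T → V, seqProb π E ℓ T as *
      (∑ t : Fin T, (ℓ t (as t) - b t) + Φ (List.ofFn as)) := by
    have h3 : ∑ t : Fin T, b t = ∑ as : Fin T → V, seqProb π E ℓ T as * ∑ t : Fin T, b t := by
      rw [← Finset.sum_mul, hone, one_mul]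
    rw [h3, ← Finset.sum_sub_distrib]
    refine Finset.sum_le_sum fun as _ => ?_
    rw [← mul_sub]
    refine mul_le_mul_of_nonneg_left ?_ (seqProb_nonneg π E ℓ T as)
    rw [Finset.sum_sub_distrib]
    linarith [hΦ (List.ofFn as)]
  rw [expectedLoss]
  linarith [key T]

/-- The block of arms that are assigned to `B` by the partition map `c`. -/
def block {V D : Type} [Fintype V] [DecidableEq D] (c : V → D) (B : D) : Finset V :=
  Finset.univ.filter fun v => c v = B

theorem mem_block {V D : Type} [Fintype V] [DecidableEq D] {c : V → D} {B : D} {v : V} :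
    v ∈ block c B ↔ c v = B := by
  simp [block]

theorem sum_block_sum {V D : Type} [Fintype V] [Fintype D] [DecidableEq D] (c : V → D)
    (f : V → ℝ) : ∑ B, ∑ v ∈ block c B, f v = ∑ v, f v :=
  Finset.sum_fiberwise _ _ _

/-- Probability vectors all of whose coordinates are at least `ε`. -/
def clippedSimplex (V : Type) [Fintype V] (ε : ℝ) : Set (V → ℝ) :=
  {x | (∀ v, ε ≤ x v) ∧ ∑ v, x v = 1}

theorem isCompact_clippedSimplex (V : Type) [Fintype V] (ε : ℝ) :
    IsCompact (clippedSimplex V ε) := by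
  have hclosed : IsClosed (clippedSimplex V ε) := by
    have h1 : IsClosed {x : V → ℝ | ∀ v, ε ≤ x v} := by
      simp only [Set.ofPred_forall]
      exact isClosed_iInter fun v => isClosed_le continuous_const (continuous_apply v)
    exact h1.inter (isClosed_eq (by fun_prop) continuous_const)
  refine (isCompact_Icc (a := fun _ : V => ε)
    (b := fun _ : V => 1 - (Fintype.card V - 1) * ε)).of_isClosed_subset hclosed ?_
  rintro x ⟨hx, hsum⟩
  refine ⟨fun v => hx v, fun v => ?_⟩
  classical
  have h1 := Finset.add_sum_erase Finset.univ x (Finset.mem_univ v)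
  have h2 : ((Finset.univ.erase v).card : ℝ) * ε ≤ ∑ w ∈ Finset.univ.erase v, x w := by
    rw [← nsmul_eq_mul]
    exact Finset.card_nsmul_le_sum _ _ _ fun w _ => hx w
  rw [Finset.card_erase_of_mem (Finset.mem_univ v), Finset.card_univ,
    Nat.cast_sub (Fintype.card_pos_iff.2 ⟨v⟩), Nat.cast_one] at h2
  simp only
  linarith

/-- The objective of follow-the-regularised-leader with cumulative loss estimate `L`. -/
noncomputable def ftrlObjective {V D : Type} [Fintype V] [Fintype D] [DecidableEq D] (c : V → D)
    (r η : ℝ) (L x : V → ℝ) : ℝ :=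
  η * ∑ v, L v * x v - ∑ B, √(blockEntropy r (block c B) x)

theorem continuousOn_blockEntropy {ι : Type*} {r : ℝ} (hr : 0 < r) {s : Finset ι}
    (hs : s.Nonempty) : ContinuousOn (blockEntropy r s) {x | ∀ i, 0 < x i} := by
  have hy : ∀ x ∈ {x : ι → ℝ | ∀ i, 0 < x i}, 0 < ∑ i ∈ s, x i :=
    fun x hx => Finset.sum_pos (fun i _ => hx i) hs
  unfold blockEntropy
  refine ContinuousOn.add (by fun_prop) (continuousOn_finsetSum _ fun i _ => ?_)
  refine ContinuousOn.mul (by fun_prop) (ContinuousOn.sub ?_ ?_)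
  · exact ContinuousOn.log (by fun_prop) fun x hx => (hy x hx).ne'
  · exact ContinuousOn.log (by fun_prop) fun x hx =>
      (add_pos (hx i) (div_pos (hy x hx) hr)).ne'

theorem exists_ftrl_minimizer {V D : Type} [Fintype V] [Fintype D] [DecidableEq D] {c : V → D}
    (hc : ∀ B, (block c B).Nonempty) {r ε : ℝ} (hr : 0 < r) (hε : 0 < ε)
    (hne : (clippedSimplex V ε).Nonempty) (η : ℝ) (L : V → ℝ) :
    ∃ x ∈ clippedSimplex V ε, ∀ x' ∈ clippedSimplex V ε,
      ftrlObjective c r η L x ≤ ftrlObjective c r η L x' := by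
  have hcont : ContinuousOn (ftrlObjective c r η L) (clippedSimplex V ε) := by
    unfold ftrlObjective
    refine ContinuousOn.sub (by fun_prop) (continuousOn_finsetSum _ fun B _ => ?_)
    refine ((continuousOn_blockEntropy hr (hc B)).mono ?_).sqrt
    exact fun x hx v => hε.trans_le (hx.1 v)
  obtain ⟨x, hx, hmin⟩ := (isCompact_clippedSimplex V ε).exists_isMinOn hne hcont
  exact ⟨x, hx, fun x' hx' => hmin hx'⟩

theorem blockEntropy_pos {ι : Type*} {r : ℝ} (hr : 2 ≤ r) {s : Finset ι} (hs : s.Nonempty)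
    (hcard : (s.card : ℝ) ≤ r) {x : ι → ℝ} (hx : ∀ i ∈ s, 0 < x i) : 0 < blockEntropy r s x :=
  lt_of_lt_of_le (mul_pos (Finset.sum_pos hx hs) (Real.log_pos (by linarith)))
    (blockEntropy_bounds hr hs hcard hx).1

/-- First-order optimality of a minimiser of the FTRL objective. -/
theorem ftrl_optimality {V D : Type} [Fintype V] [Fintype D] [DecidableEq D] {c : V → D}
    (hc : ∀ B, (block c B).Nonempty) {r ε η : ℝ} (hr : 2 ≤ r)
    (hcard : ∀ B, ((block c B).card : ℝ) ≤ r) (hε : 0 < ε) {L x x' : V → ℝ}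
    (hx : x ∈ clippedSimplex V ε) (hx' : x' ∈ clippedSimplex V ε)
    (hmin : ∀ z ∈ clippedSimplex V ε, ftrlObjective c r η L x ≤ ftrlObjective c r η L z) :
    0 ≤ η * ∑ v, L v * (x' v - x v) - ∑ B,
      blockEntropyDeriv r (block c B) x (fun i => x' i - x i) /
        (2 * √(blockEntropy r (block c B) x)) := by
  set d : V → ℝ := fun i => x' i - x i with hd
  have hxpos : ∀ v, 0 < x v := fun v => hε.trans_le (hx.1 v)
  have hderiv : HasDerivAt (fun t : ℝ => ftrlObjective c r η L (fun i => x i + t * d i))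
      (η * ∑ v, L v * d v - ∑ B, blockEntropyDeriv r (block c B) x d /
        (2 * √(blockEntropy r (block c B) x))) 0 := by
    unfold ftrlObjective
    refine HasDerivAt.fun_sub ?_ (HasDerivAt.fun_sum fun B _ => ?_)
    · refine (HasDerivAt.fun_sum fun v _ => ?_).const_mul η
      have : HasDerivAt (fun t : ℝ => x v + t * d v) (d v) 0 := by
        simpa using ((hasDerivAt_id (0 : ℝ)).mul_const (d v)).const_add (x v)
      exact this.const_mul (L v)
    · have h1 := hasDerivAt_blockEntropy (by linarith : 0 < r) (hc B) d fun i _ => hxpos i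
      have h2 := h1.sqrt (by
        simpa using (blockEntropy_pos hr (hc B) (hcard B) fun i _ => hxpos i).ne')
      simpa using h2
  have hslope := (hasDerivWithinAt_iff_tendsto_slope' Set.self_notMem_Ioi).mp
    (hderiv.hasDerivWithinAt (s := Set.Ioi 0))
  refine ge_of_tendsto (b := (0 : ℝ)) hslope ?_
  filter_upwards [Ioo_mem_nhdsGT (zero_lt_one' ℝ)] with t ht
  rw [slope_def_field]
  refine div_nonneg (sub_nonneg.2 ?_) (by linarith [ht.1])
  simp only [zero_mul, add_zero]
  refine hmin _ ⟨fun v => ?_, ?_⟩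
  · have h1 := hx.1 v
    have h2 := hx'.1 v
    simp only [hd]
    nlinarith [ht.1, ht.2]
  · simp only [hd]
    rw [Finset.sum_add_distrib, ← Finset.mul_sum, Finset.sum_sub_distrib, hx.2, hx'.2]
    ring

/-- One step of follow-the-regularised-leader: the optimal value grows by at least the loss of the
current iterate, up to a variance term. -/
theorem ftrl_step {V D : Type} [Fintype V] [Fintype D] [DecidableEq D] {c : V → D}
    (hc : ∀ B, (block c B).Nonempty) {r ε η : ℝ} (hr : 2 ≤ r)
    (hcard : ∀ B, ((block c B).card : ℝ) ≤ r) (hε : 0 < ε) (hη : 0 < η) {L x x' e : V → ℝ}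
    (hx : x ∈ clippedSimplex V ε) (hx' : x' ∈ clippedSimplex V ε)
    (hmin : ∀ z ∈ clippedSimplex V ε, ftrlObjective c r η L x ≤ ftrlObjective c r η L z)
    {m : D → ℝ} (hm : ∀ B, 0 ≤ m B) (he0 : ∀ v, 0 ≤ e v) (hem : ∀ v, e v ≤ m (c v)) :
    ftrlObjective c r η L x + η * ∑ v, e v * x v - 32 * η ^ 2 * ∑ B, m B ^ 2 *
        ((∑ v ∈ block c B, x v) * √(blockEntropy r (block c B) x)) ≤
      ftrlObjective c r η (fun v => L v + e v) x' := by
  have hxpos : ∀ v, 0 < x v := fun v => hε.trans_le (hx.1 v)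
  have hxpos' : ∀ v, 0 < x' v := fun v => hε.trans_le (hx'.1 v)
  have hopt := ftrl_optimality hc hr hcard hε hx hx' hmin
  have hstab := Finset.sum_le_sum fun (B : D) (_ : B ∈ Finset.univ) =>
    block_stability hr (hc B) (hcard B) (x := x) (x' := x') (e := fun v => η * e v)
      (fun i _ => hxpos i) (fun i _ => hxpos' i) (mul_nonneg hη.le (hm B))
      (fun i _ => mul_nonneg hη.le (he0 i))
      (fun i hi => mul_le_mul_of_nonneg_left (mem_block.1 hi ▸ hem i) hη.le)
  rw [Finset.sum_sub_distrib, Finset.sum_sub_distrib, Finset.sum_add_distrib, sum_block_sum]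
    at hstab
  have h1 : ∑ B, 32 * (η * m B) ^ 2 * (∑ v ∈ block c B, x v) * √(blockEntropy r (block c B) x) =
      32 * η ^ 2 * ∑ B, m B ^ 2 *
        ((∑ v ∈ block c B, x v) * √(blockEntropy r (block c B) x)) := by
    rw [Finset.mul_sum]
    exact Finset.sum_congr rfl fun B _ => by ring
  have h2 : ∑ v, η * e v * (x v - x' v) = η * ∑ v, e v * x v - η * ∑ v, e v * x' v := by
    rw [← mul_sub, ← Finset.sum_sub_distrib, Finset.mul_sum]
    exact Finset.sum_congr rfl fun v _ => by ring
  have h3 : ∑ v, (L v + e v) * x' v = ∑ v, L v * x' v + ∑ v, e v * x' v := by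
    rw [← Finset.sum_add_distrib]
    exact Finset.sum_congr rfl fun v _ => by ring
  have h4 : ∑ v, L v * (x' v - x v) = ∑ v, L v * x' v - ∑ v, L v * x v := by
    rw [← Finset.sum_sub_distrib]
    exact Finset.sum_congr rfl fun v _ => by ring
  rw [h1, h2] at hstab
  rw [h4] at hopt
  unfold ftrlObjective
  rw [h3]
  linarith

theorem sum_sqrt_blockEntropy_le {V D : Type} [Fintype V] [Fintype D] [DecidableEq D] {c : V → D}
    (hc : ∀ B, (block c B).Nonempty) {r ε : ℝ} (hr : 2 ≤ r)
    (hcard : ∀ B, ((block c B).card : ℝ) ≤ r) (hε : 0 < ε) {x : V → ℝ}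
    (hx : x ∈ clippedSimplex V ε) :
    ∑ B, √(blockEntropy r (block c B) x) ≤ √(5 * (Fintype.card D * Real.log r)) := by
  have hxpos : ∀ v, 0 < x v := fun v => hε.trans_le (hx.1 v)
  apply Real.le_sqrt_of_sq_le
  calc _ ≤ (Finset.univ.card : ℝ) * ∑ B, √(blockEntropy r (block c B) x) ^ 2 :=
        sq_sum_le_card_mul_sum_sq
    _ ≤ (Finset.univ.card : ℝ) * ∑ B, 5 * Real.log r * ∑ v ∈ block c B, x v := by
        gcongr with B
        rw [Real.sq_sqrt (blockEntropy_pos hr (hc B) (hcard B) fun i _ => hxpos i).le]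
        exact (blockEntropy_bounds hr (hc B) (hcard B) fun i _ => hxpos i).2
    _ = _ := by
        rw [← Finset.mul_sum, sum_block_sum, hx.2, Finset.card_univ]
        ring

/-- Play `x` with probability `1 - γ`; otherwise sample a block according to its mass under `x` and
play the arm `u B` observing it. -/
noncomputable def exploringDist {V D : Type} [Fintype V] [Fintype D] [DecidableEq V]
    [DecidableEq D] (c : V → D) (u : D → V) (γ : ℝ) (x : V → ℝ) (a : V) : ℝ :=
  (1 - γ) * x a + γ * ∑ B, if u B = a then ∑ v ∈ block c B, x v else 0

/-- The importance-weighted loss estimate after playing `a` and observing the feedback `F`. -/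
noncomputable def lossEstimate {V D : Type} [Fintype V] [Fintype D] [DecidableEq V]
    [DecidableEq D] (c : V → D) (u : D → V) (γ : ℝ) (x : V → ℝ) (a : V) (F : V → Option ℝ)
    (v : V) : ℝ :=
  if u (c v) = a then (F v).getD 0 / exploringDist c u γ x a else 0

section exploring

variable {V D : Type} [Fintype V] [Fintype D] [DecidableEq V] [DecidableEq D] {c : V → D}
  {u : D → V} {γ : ℝ} {x : V → ℝ}

theorem exploringDist_nonneg (hγ0 : 0 ≤ γ) (hγ1 : γ ≤ 1) (hx : ∀ v, 0 ≤ x v) (a : V) :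
    0 ≤ exploringDist c u γ x a := by
  refine add_nonneg (mul_nonneg (by linarith) (hx a)) (mul_nonneg hγ0
    (Finset.sum_nonneg fun B _ => ?_))
  split_ifs
  · exact Finset.sum_nonneg fun v _ => hx v
  · exact le_rfl

theorem le_exploringDist (hγ0 : 0 ≤ γ) (hγ1 : γ ≤ 1) (hx : ∀ v, 0 ≤ x v) (B : D) :
    γ * ∑ v ∈ block c B, x v ≤ exploringDist c u γ x (u B) := by
  have h1 : (if u B = u B then ∑ v ∈ block c B, x v else 0) ≤
      ∑ B', if u B' = u B then ∑ v ∈ block c B', x v else 0 := by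
    refine Finset.single_le_sum
      (f := fun B' => if u B' = u B then ∑ v ∈ block c B', x v else 0)
      (fun B' _ => ?_) (Finset.mem_univ B)
    split_ifs
    · exact Finset.sum_nonneg fun v _ => hx v
    · exact le_rfl
  rw [if_pos rfl] at h1
  have h2 := mul_le_mul_of_nonneg_left h1 hγ0
  have h3 : 0 ≤ (1 - γ) * x (u B) := mul_nonneg (by linarith) (hx _)
  unfold exploringDist
  linarith

theorem sum_exploringDist_mul (f : V → ℝ) :
    ∑ a, exploringDist c u γ x a * f a =
      (1 - γ) * ∑ a, x a * f a + γ * ∑ B, (∑ v ∈ block c B, x v) * f (u B) := by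
  simp only [exploringDist, add_mul, Finset.sum_add_distrib, Finset.mul_sum, Finset.sum_mul]
  congr 1
  · exact Finset.sum_congr rfl fun a _ => by ring
  · rw [Finset.sum_comm]
    refine Finset.sum_congr rfl fun B _ => ?_
    simp only [mul_ite, ite_mul, mul_zero, zero_mul, Finset.sum_ite_eq, Finset.mem_univ, if_true]
    rw [Finset.mul_sum, Finset.sum_mul]
    exact Finset.sum_congr rfl fun v _ => by ring

theorem sum_exploringDist (hx : ∑ v, x v = 1) : ∑ a, exploringDist c u γ x a = 1 := by
  have := sum_exploringDist_mul (c := c) (u := u) (γ := γ) (x := x) (fun _ => 1)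
  simp only [mul_one, sum_block_sum, hx] at this
  linarith

theorem sum_exploringDist_mul_le (hγ0 : 0 ≤ γ) (hx0 : ∀ v, 0 ≤ x v) (hx : ∑ v, x v = 1)
    {ℓ : V → ℝ} (hℓ0 : ∀ v, 0 ≤ ℓ v) (hℓ1 : ∀ v, ℓ v ≤ 1) :
    ∑ a, exploringDist c u γ x a * ℓ a ≤ ∑ v, x v * ℓ v + γ := by
  rw [sum_exploringDist_mul]
  have h1 : ∑ B, (∑ v ∈ block c B, x v) * ℓ (u B) ≤ 1 := by
    calc _ ≤ ∑ B, (∑ v ∈ block c B, x v) := Finset.sum_le_sum fun B _ =>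
          mul_le_of_le_one_right (Finset.sum_nonneg fun v _ => hx0 v) (hℓ1 _)
      _ = 1 := by rw [sum_block_sum, hx]
  have h2 : 0 ≤ ∑ v, x v * ℓ v := Finset.sum_nonneg fun v _ => mul_nonneg (hx0 v) (hℓ0 v)
  nlinarith

theorem lossEstimate_feedback {E : V → V → Bool} (hu : ∀ v, E (u (c v)) v = true) (ℓ : V → ℝ)
    (a v : V) : lossEstimate c u γ x a (feedbackOf E ℓ a) v =
      if u (c v) = a then ℓ v / exploringDist c u γ x a else 0 := by
  unfold lossEstimate
  split_ifs with h
  · subst h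
    simp [feedbackOf, hu]
  · rfl

end exploring

theorem exists_pmf_toReal_eq {V : Type} [Fintype V] (f : V → ℝ) (h0 : ∀ v, 0 ≤ f v)
    (h1 : ∑ v, f v = 1) : ∃ p : PMF V, ∀ v, (p v).toReal = f v := by
  refine ⟨PMF.ofFintype (fun v => ENNReal.ofReal (f v)) ?_, fun v => ?_⟩
  · rw [← ENNReal.ofReal_sum_of_nonneg fun v _ => h0 v, h1, ENNReal.ofReal_one]
  · rw [PMF.ofFintype_apply, ENNReal.toReal_ofReal (h0 v)]

/-- One round of the algorithm, in expectation, for a potential `m` (the optimal FTRL value). -/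
theorem expected_ftrl_step {V D : Type} [Fintype V] [Fintype D] [DecidableEq V] [DecidableEq D]
    {c : V → D} {u : D → V} {E : V → V → Bool} (hu : ∀ v, E (u (c v)) v = true)
    (hc : ∀ B, (block c B).Nonempty) {r ε η γ : ℝ} (hr : 2 ≤ r)
    (hcard : ∀ B, ((block c B).card : ℝ) ≤ r) (hε : 0 < ε) (hη : 0 < η) (hγ0 : 0 < γ) (hγ1 : γ ≤ 1)
    {X : (V → ℝ) → V → ℝ} (hX : ∀ L, X L ∈ clippedSimplex V ε)
    (hmin : ∀ L, ∀ z ∈ clippedSimplex V ε,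
      ftrlObjective c r η L (X L) ≤ ftrlObjective c r η L z)
    (L w ℓ : V → ℝ) (hℓ0 : ∀ v, 0 ≤ ℓ v) (hℓ1 : ∀ v, ℓ v ≤ 1) :
    ∑ a, exploringDist c u γ (X L) a * (ℓ a +
        (∑ v, (L v + lossEstimate c u γ (X L) a (feedbackOf E ℓ a) v) * w v -
          ftrlObjective c r η (fun v => L v + lossEstimate c u γ (X L) a (feedbackOf E ℓ a) v)
            (X fun v => L v + lossEstimate c u γ (X L) a (feedbackOf E ℓ a) v) / η)) ≤
      (∑ v, L v * w v - ftrlObjective c r η L (X L) / η) + (∑ v, ℓ v * w v + γ +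
        32 * η / γ * √(5 * (Fintype.card D * Real.log r))) := by
  set x := X L with hxdef
  have hxpos : ∀ v, 0 < x v := fun v => hε.trans_le ((hX L).1 v)
  have hxs : ∑ v, x v = 1 := (hX L).2
  set P := exploringDist c u γ x with hP
  have hP0 : ∀ a, 0 ≤ P a := exploringDist_nonneg hγ0.le hγ1 fun v => (hxpos v).le
  have hPs : ∑ a, P a = 1 := sum_exploringDist hxs
  have hy : ∀ B, 0 < ∑ v ∈ block c B, x v := fun B => Finset.sum_pos (fun v _ => hxpos v) (hc B)
  have hPB : ∀ B, γ * ∑ v ∈ block c B, x v ≤ P (u B) :=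
    le_exploringDist hγ0.le hγ1 fun v => (hxpos v).le
  have hPB0 : ∀ B, 0 < P (u B) := fun B => (mul_pos hγ0 (hy B)).trans_le (hPB B)
  set e : V → V → ℝ := fun a => lossEstimate c u γ x a (feedbackOf E ℓ a) with he
  have heq : ∀ a v, e a v = if u (c v) = a then ℓ v / P a else 0 := fun a v =>
    lossEstimate_feedback hu ℓ a v
  set q : D → ℝ := fun B => √(blockEntropy r (block c B) x) with hq
  set m : V → D → ℝ := fun a B => if u B = a then 1 / P a else 0 with hm
  have hround : ∀ a, ∑ v, (L v + e a v) * w v -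
      ftrlObjective c r η (fun v => L v + e a v) (X fun v => L v + e a v) / η ≤
      (∑ v, L v * w v - ftrlObjective c r η L x / η) + ∑ v, e a v * (w v - x v) +
        32 * η * ∑ B, m a B ^ 2 * ((∑ v ∈ block c B, x v) * q B) := by
    intro a
    have h1 := ftrl_step (e := e a) (m := m a) hc hr hcard hε hη (hX L)
      (hX fun v => L v + e a v) (hmin L)
      (fun B => by
        simp only [hm]; split_ifs
        · exact one_div_nonneg.2 (hP0 a)
        · exact le_rfl)
      (fun v => by
        rw [heq]; split_ifs
        · exact div_nonneg (hℓ0 v) (hP0 a)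
        · exact le_rfl)
      (fun v => by
        rw [heq]; simp only [hm]; split_ifs
        · exact div_le_div_of_nonneg_right (hℓ1 v) (hP0 a)
        · exact le_rfl)
    have h2 := div_le_div_of_nonneg_right h1 hη.le
    have h3 : (ftrlObjective c r η L x + η * ∑ v, e a v * x v - 32 * η ^ 2 *
        ∑ B, m a B ^ 2 * ((∑ v ∈ block c B, x v) * q B)) / η = ftrlObjective c r η L x / η +
        ∑ v, e a v * x v - 32 * η * ∑ B, m a B ^ 2 * ((∑ v ∈ block c B, x v) * q B) := by
      field_simp
    rw [h3] at h2
    have h4 : ∑ v, (L v + e a v) * w v = ∑ v, L v * w v + ∑ v, e a v * w v := by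
      rw [← Finset.sum_add_distrib]
      exact Finset.sum_congr rfl fun v _ => by ring
    have h5 : ∑ v, e a v * (w v - x v) = ∑ v, e a v * w v - ∑ v, e a v * x v := by
      rw [← Finset.sum_sub_distrib]
      exact Finset.sum_congr rfl fun v _ => by ring
    rw [h4, h5]
    linarith
  have hunbiased : ∑ a, P a * ∑ v, e a v * (w v - x v) = ∑ v, ℓ v * w v - ∑ v, x v * ℓ v := by
    rw [← Finset.sum_sub_distrib]
    simp only [Finset.mul_sum]
    rw [Finset.sum_comm]
    refine Finset.sum_congr rfl fun v _ => ?_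
    simp only [heq, ite_mul, mul_ite, zero_mul, mul_zero, Finset.sum_ite_eq, Finset.mem_univ,
      if_true]
    have := (hPB0 (c v)).ne'
    field_simp
  have hvar : ∑ a, P a * ∑ B, m a B ^ 2 * ((∑ v ∈ block c B, x v) * q B) ≤
      1 / γ * √(5 * (Fintype.card D * Real.log r)) := by
    refine le_trans ?_ (mul_le_mul_of_nonneg_left
      (sum_sqrt_blockEntropy_le hc hr hcard hε (hX L)) (one_div_nonneg.2 hγ0.le))
    simp only [Finset.mul_sum]
    rw [Finset.sum_comm]
    refine Finset.sum_le_sum fun B _ => ?_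
    simp only [hm, ite_pow, ite_mul, mul_ite, ne_eq, OfNat.ofNat_ne_zero, not_false_eq_true,
      zero_pow, zero_mul, mul_zero, Finset.sum_ite_eq, Finset.mem_univ, if_true]
    have h1 : P (u B) * ((1 / P (u B)) ^ 2 * ((∑ v ∈ block c B, x v) * q B)) =
        ((∑ v ∈ block c B, x v) / P (u B)) * q B := by
      have := (hPB0 B).ne'
      field_simp
    rw [h1]
    refine mul_le_mul_of_nonneg_right ?_ (Real.sqrt_nonneg _)
    rw [div_le_div_iff₀ (hPB0 B) hγ0]
    linarith [hPB B]
  have hloss : ∑ a, P a * ℓ a ≤ ∑ v, x v * ℓ v + γ :=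
    sum_exploringDist_mul_le hγ0.le (fun v => (hxpos v).le) hxs hℓ0 hℓ1
  set Φ := ∑ v, L v * w v - ftrlObjective c r η L x / η with hΦ
  set S := √(5 * (Fintype.card D * Real.log r)) with hS
  have hfin : 32 * η * (1 / γ * S) = 32 * η / γ * S := by ring
  calc _ ≤ ∑ a, P a * (ℓ a + (Φ + ∑ v, e a v * (w v - x v) +
        32 * η * ∑ B, m a B ^ 2 * ((∑ v ∈ block c B, x v) * q B))) :=
        Finset.sum_le_sum fun a _ => mul_le_mul_of_nonneg_left
          (add_le_add_right (hround a) _) (hP0 a)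
    _ = ∑ a, P a * ℓ a + (∑ a, P a) * Φ + ∑ a, P a * ∑ v, e a v * (w v - x v) + 32 * η *
        ∑ a, P a * ∑ B, m a B ^ 2 * ((∑ v ∈ block c B, x v) * q B) := by
        rw [Finset.sum_mul, Finset.mul_sum, ← Finset.sum_add_distrib, ← Finset.sum_add_distrib,
          ← Finset.sum_add_distrib]
        exact Finset.sum_congr rfl fun a _ => by ring
    _ ≤ _ := by
        rw [hPs, hunbiased, ← hfin]
        have := mul_le_mul_of_nonneg_left hvar (by positivity : 0 ≤ 32 * η)
        linarith

theorem exists_policy_regret_le {V D : Type} [Fintype V] [Nonempty V] [Fintype D]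
    [DecidableEq D] (E : V → V → Bool) {c : V → D} {u : D → V}
    (hu : ∀ v, E (u (c v)) v = true) (hc : ∀ B, (block c B).Nonempty) {r η γ : ℝ} (hr : 2 ≤ r)
    (hcard : ∀ B, ((block c B).card : ℝ) ≤ r) (hη : 0 < η) (hγ0 : 0 < γ) (hγ1 : γ ≤ 1) :
    ∃ π : Policy V, ∀ ℓ, ValidLoss ℓ → ∀ T : ℕ, regret π E ℓ T ≤
      √(5 * (Fintype.card D * Real.log r)) / η +
        T * (2 * γ + 32 * η / γ * √(5 * (Fintype.card D * Real.log r))) := by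
  classical
  set S := √(5 * (Fintype.card D * Real.log r)) with hS
  have hN : (0 : ℝ) < Fintype.card V := by exact_mod_cast Fintype.card_pos
  set ε := γ / Fintype.card V with hεdef
  have hε : 0 < ε := div_pos hγ0 hN
  have hεN : Fintype.card V * ε = γ := mul_div_cancel₀ _ hN.ne'
  -- the comparator which is concentrated on a single arm, up to clipping
  set w : V → V → ℝ := fun a v => (1 - γ) * (if v = a then 1 else 0) + ε with hw
  have hwmem : ∀ a, w a ∈ clippedSimplex V ε := by
    refine fun a => ⟨fun v => ?_, ?_⟩
    · simp only [hw]
      have : 0 ≤ (1 - γ) * (if v = a then (1 : ℝ) else 0) :=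
        mul_nonneg (by linarith) (by split_ifs <;> norm_num)
      linarith
    · simp only [hw]
      rw [Finset.sum_add_distrib, ← Finset.mul_sum, Finset.sum_ite_eq', Finset.sum_const,
        Finset.card_univ, nsmul_eq_mul, hεN]
      simp
  obtain ⟨a₀⟩ := ‹Nonempty V›
  choose X hX hmin using fun L =>
    exists_ftrl_minimizer hc (by linarith : 0 < r) hε ⟨_, hwmem a₀⟩ η L
  have hX0 : ∀ L v, 0 ≤ X L v := fun L v => hε.le.trans ((hX L).1 v)
  set step : (V → ℝ) → V × (V → Option ℝ) → V → ℝ := fun L p v =>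
    L v + lossEstimate c u γ (X L) p.1 p.2 v with hstepdef
  choose p hp using fun L => exists_pmf_toReal_eq (exploringDist c u γ (X L))
    (exploringDist_nonneg hγ0.le hγ1 (hX0 L)) (sum_exploringDist (hX L).2)
  refine ⟨fun h => p (h.foldl step 0), fun ℓ hℓ T => ?_⟩
  have hreg : ∀ a, expectedLoss (fun h => p (h.foldl step 0)) E ℓ T ≤ ∑ t : Fin T, ℓ t a +
      (S / η + T * (2 * γ + 32 * η / γ * S)) := by
    intro a
    set est : List V → V → ℝ := fun as => (hist E ℓ as).foldl step 0 with hest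
    have hpot := expectedLoss_le_of_potential (fun h => p (h.foldl step 0)) E ℓ
      (fun as => ∑ v, est as v * w a v - ftrlObjective c r η (est as) (X (est as)) / η)
      (fun as => by
        have h1 := hmin (est as) (w a) (hwmem a)
        have h2 : ftrlObjective c r η (est as) (w a) ≤ η * ∑ v, est as v * w a v := by
          unfold ftrlObjective
          exact sub_le_self _ (Finset.sum_nonneg fun B _ => Real.sqrt_nonneg _)
        rw [sub_nonneg, div_le_iff₀ hη]
        linarith)
      (fun t => ∑ v, ℓ t v * w a v + γ + 32 * η / γ * S)
      (fun as => by
        have := expected_ftrl_step hu hc hr hcard hε hη hγ0 hγ1 hX hmin (est as) (w a)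
          (ℓ as.length) (fun v => (hℓ _ v).1) (fun v => (hℓ _ v).2)
        simp only [hp]
        have h2 : ∀ b, est (as ++ [b]) = fun v => est as v + lossEstimate c u γ (X (est as)) b
            (feedbackOf E (ℓ as.length) b) v := by
          intro b
          simp only [hest, hist_concat, List.foldl_append, List.foldl_cons, List.foldl_nil,
            hstepdef]
        simp only [h2]
        exact this) T
    have h0 : ∑ v, est [] v * w a v - ftrlObjective c r η (est []) (X (est [])) / η ≤ S / η := by
      have h1 : est [] = 0 := rfl
      have h2 := sum_sqrt_blockEntropy_le hc hr hcard hε (hX (est []))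
      rw [h1] at h2 ⊢
      simp only [Pi.zero_apply, zero_mul, Finset.sum_const_zero, ftrlObjective, mul_zero,
        zero_sub]
      rw [← neg_div, neg_neg]
      exact div_le_div_of_nonneg_right h2 hη.le
    have hcomp : ∀ t, ∑ v, ℓ t v * w a v ≤ ℓ t a + γ := by
      intro t
      have h1 : ∑ v, ℓ t v * w a v = (1 - γ) * ℓ t a + ε * ∑ v, ℓ t v := by
        simp only [hw, mul_add, Finset.sum_add_distrib, Finset.mul_sum]
        congr 1
        · simp [mul_comm]
        · exact Finset.sum_congr rfl fun v _ => mul_comm _ _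
      have h2 : ∑ v, ℓ t v ≤ Fintype.card V := by
        calc _ ≤ ∑ _v : V, (1 : ℝ) := Finset.sum_le_sum fun v _ => (hℓ t v).2
          _ = _ := by simp
      have h3 := mul_le_mul_of_nonneg_left h2 hε.le
      have h4 := mul_nonneg hγ0.le (hℓ t a).1
      rw [h1]
      linarith
    have hsum : ∑ t : Fin T, (∑ v, ℓ t v * w a v + γ + 32 * η / γ * S) ≤
        ∑ t : Fin T, ℓ t a + T * (2 * γ + 32 * η / γ * S) := by
      calc _ ≤ ∑ t : Fin T, (ℓ t a + (2 * γ + 32 * η / γ * S)) :=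
            Finset.sum_le_sum fun t _ => by linarith [hcomp t]
        _ = _ := by
            simp only [Finset.sum_add_distrib, Finset.sum_const, Finset.card_univ,
              Fintype.card_fin, nsmul_eq_mul]
            ring
    linarith
  have : Nonempty V := ⟨a₀⟩
  obtain ⟨a, ha⟩ := exists_eq_ciInf_of_finite (f := fun a : V => ∑ t : Fin T, ℓ t a)
  unfold regret
  rw [← ha]
  linarith [hreg a]

theorem minimaxRegret_le_of_policy {V : Type} [Fintype V] {E : V → V → Bool} {T : ℕ} {R : ℝ}
    (hR : 0 ≤ R) (π : Policy V) (hπ : ∀ ℓ, ValidLoss ℓ → regret π E ℓ T ≤ R) :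
    minimaxRegret V E T ≤ R := by
  have hsup : ⨆ ℓ : {ℓ : ℕ → V → ℝ // ValidLoss ℓ}, regret π E ℓ.1 T ≤ R :=
    have : Nonempty {ℓ : ℕ → V → ℝ // ValidLoss ℓ} :=
      ⟨⟨fun _ _ => 0, fun _ _ => ⟨le_rfl, zero_le_one⟩⟩⟩
    ciSup_le fun ℓ => hπ ℓ.1 ℓ.2
  unfold minimaxRegret
  by_cases hbdd : BddBelow (Set.range fun π : Policy V =>
      ⨆ ℓ : {ℓ : ℕ → V → ℝ // ValidLoss ℓ}, regret π E ℓ.1 T)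
  · exact (ciInf_le hbdd π).trans hsup
  · rw [Real.iInf_of_not_bddBelow hbdd]
    exact hR

section hypercube

variable {ι G : Type} [DecidableEq ι]

/-- The vertex `x` of the hypercube with its `i`-th coordinate flipped. -/
def flipCoord (x : ι → Bool) (i : ι) : ι → Bool :=
  Function.update x i (!x i)

theorem flipCoord_flipCoord (x : ι → Bool) (i : ι) : flipCoord (flipCoord x i) i = x := by
  simp [flipCoord]

theorem flipCoord_ne_iff (x : ι → Bool) (i j : ι) : flipCoord x i j ≠ x j ↔ j = i := by
  by_cases h : j = i
  · subst h
    simp [flipCoord]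
  · simp [flipCoord, h]

/-- The syndrome of a vertex: the sum of the labels `g` of the coordinates `e g` that are set. -/
def syndrome [Fintype G] [AddCommGroup G] (e : G ↪ ι) (x : ι → Bool) : G :=
  ∑ g, if x (e g) then g else 0

theorem syndrome_flipCoord [Fintype G] [AddCommGroup G] (hG : ∀ g : G, g + g = 0) (e : G ↪ ι)
    (x : ι → Bool) (g : G) : syndrome e (flipCoord x (e g)) = syndrome e x + g := by
  classical
  have h : ∀ h : G, (if flipCoord x (e g) (e h) then h else 0) =
      (if x (e h) then h else 0) + if h = g then g else 0 := by
    intro h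
    by_cases hg : h = g
    · subst hg
      cases hx : x (e h) <;> simp [flipCoord, hx, hG]
    · simp [flipCoord, hg]
  simp only [syndrome, h, Finset.sum_add_distrib, Finset.sum_ite_eq', Finset.mem_univ, if_true]

end hypercube

/-- The hypercube can be partitioned into at most `2 * 2 ^ n / n` sets, each of them contained in
the neighborhood of a single vertex (a shortened Hamming code). -/
theorem exists_hypercube_partition {n : ℕ} (hn : n ≠ 0) :
    ∃ (D : Type) (_ : Fintype D) (_ : DecidableEq D) (c : (Fin n → Bool) → D)
      (u : D → Fin n → Bool),
      (∀ v, (Finset.univ.filter fun i => u (c v) i ≠ v i).card = 1) ∧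
      (∀ B, (block c B).Nonempty) ∧ (∀ B, (block c B).card ≤ n) ∧
      Fintype.card D * n ≤ 2 * 2 ^ n := by
  classical
  set k := Nat.log 2 n with hk
  let G : Type := Fin k → ZMod 2
  have hG : ∀ g : G, g + g = 0 := fun g => funext fun i => CharTwo.add_self_eq_zero (g i)
  have hGcard : Fintype.card G = 2 ^ k := by simp [G]
  have hkn : 2 ^ k ≤ n := Nat.pow_log_le_self 2 hn
  obtain ⟨e⟩ : Nonempty (G ↪ Fin n) :=
    Function.Embedding.nonempty_of_card_le (by rw [hGcard, Fintype.card_fin]; exact hkn)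
  have hflip := syndrome_flipCoord hG e
  refine ⟨{x : Fin n → Bool // syndrome e x = 0}, inferInstance, inferInstance,
    fun x => ⟨flipCoord x (e (syndrome e x)), by rw [hflip, hG]⟩, Subtype.val, fun v => ?_,
    fun B => ⟨flipCoord B.1 (e 0), ?_⟩, fun B => ?_, ?_⟩
  · simp only [flipCoord_ne_iff]
    rw [Finset.card_eq_one]
    exact ⟨e (syndrome e v), by ext; simp⟩
  · rw [mem_block]
    refine Subtype.ext ?_
    simp only [hflip, B.2, add_zero, flipCoord_flipCoord]
  · refine le_trans ?_ (hGcard.le.trans hkn)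
    refine (Finset.card_le_card (t := Finset.univ.image fun g => flipCoord B.1 (e g)) ?_).trans
      Finset.card_image_le
    intro v hv
    rw [mem_block] at hv
    refine Finset.mem_image.2 ⟨syndrome e v, Finset.mem_univ _, ?_⟩
    rw [← hv]
    exact flipCoord_flipCoord _ _
  · have hcard := Fintype.card_le_of_injective
      (fun p : {x : Fin n → Bool // syndrome e x = 0} × G => flipCoord p.1.1 (e p.2)) (by
        rintro ⟨⟨x, hx⟩, g⟩ ⟨⟨y, hy⟩, h⟩ hxy
        simp only at hxy
        have h1 := congrArg (syndrome e) hxy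
        rw [hflip, hflip, hx, hy, zero_add, zero_add] at h1
        subst h1
        have h2 := congrArg (fun z => flipCoord z (e g)) hxy
        simp only [flipCoord_flipCoord] at h2
        subst h2
        rfl)
    rw [Fintype.card_prod, hGcard, Fintype.card_fun, Fintype.card_bool, Fintype.card_fin] at hcard
    have hlt : n ≤ 2 ^ (k + 1) := (Nat.lt_pow_succ_log_self one_lt_two n).le
    calc _ ≤ _ * 2 ^ (k + 1) := Nat.mul_le_mul_left _ hlt
      _ = 2 * (_ * 2 ^ k) := by ring
      _ ≤ _ := Nat.mul_le_mul_left _ hcard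

/-- The tuning of the learning rate `η` and of the exploration rate `γ`. -/
theorem exists_tuned_parameters {M T : ℝ} (hM : 0 < M) (hMT : M ≤ T) :
    ∃ η γ : ℝ, 0 < η ∧ 0 < γ ∧ γ ≤ 1 ∧ √(5 * M) / η + T * (2 * γ + 32 * η / γ * √(5 * M)) ≤
      101 * (M ^ ((1 : ℝ) / 3) * T ^ ((2 : ℝ) / 3)) := by
  have hT : 0 < T := hM.trans_le hMT
  set s := M ^ ((1 : ℝ) / 3) with hs
  set t := T ^ ((1 : ℝ) / 3) with ht
  have hs0 : 0 < s := Real.rpow_pos_of_pos hM _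
  have ht0 : 0 < t := Real.rpow_pos_of_pos hT _
  have hs3 : s ^ 3 = M := by
    rw [hs, ← Real.rpow_natCast, ← Real.rpow_mul hM.le]; norm_num
  have ht3 : t ^ 3 = T := by
    rw [ht, ← Real.rpow_natCast, ← Real.rpow_mul hT.le]; norm_num
  have ht2 : T ^ ((2 : ℝ) / 3) = t ^ 2 := by
    rw [ht, ← Real.rpow_natCast, ← Real.rpow_mul hT.le]; norm_num
  have hst : s ≤ t := Real.rpow_le_rpow hM.le hMT (by norm_num)
  have hsqrt : √(5 * M) ≤ 3 * (s * √s) := by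
    rw [Real.sqrt_le_left (by positivity), mul_pow, mul_pow, Real.sq_sqrt hs0.le, ← hs3]
    nlinarith [pow_pos hs0 3]
  have hr : 0 < √s := Real.sqrt_pos.2 hs0
  have hr2 : √s ^ 2 = s := Real.sq_sqrt hs0.le
  refine ⟨√s / t ^ 2, s / t, by positivity, by positivity, (div_le_one ht0).2 hst, ?_⟩
  rw [ht2, ← ht3]
  calc _ = √(5 * M) * (t ^ 2 / √s) + t ^ 3 * (2 * (s / t)) +
        √(5 * M) * (t ^ 3 * (32 * (√s / t ^ 2) / (s / t))) := by
        rw [div_div_eq_mul_div]; ring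
    _ ≤ 3 * (s * √s) * (t ^ 2 / √s) + t ^ 3 * (2 * (s / t)) +
        3 * (s * √s) * (t ^ 3 * (32 * (√s / t ^ 2) / (s / t))) := by gcongr
    _ = 3 * (s * t ^ 2) + 2 * (s * t ^ 2) + 96 * (√s ^ 2 * t ^ 2) := by field_simp; ring
    _ = _ := by rw [hr2]; ring

/-- There is a universal constant `c > 0` such that for every `n ≥ 2`,
the mini-max regret of the hypercube feedback graph `Q_n` on `N = 2^n` vertices is at
most `c · ((N/n) · log n)^{1/3} · T^{2/3}` for all sufficiently large `T`.  Vertices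
are elements of `{0,1}^n` and two vertices are joined iff their Hamming distance is 1. -/
theorem hypercube_minimax_upper_bound :
    ∃ c : ℝ, 0 < c ∧
      ∀ n : ℕ, 2 ≤ n →
        ∃ T₀ : ℕ, ∀ T : ℕ, T₀ ≤ T →
          minimaxRegret (Fin n → Bool)
              (fun x y => decide ((Finset.univ.filter (fun i => x i ≠ y i)).card = 1)) T ≤
            c * (((2 : ℝ) ^ n / (n : ℝ)) * Real.log n) ^ ((1 : ℝ) / 3) *
              (T : ℝ) ^ ((2 : ℝ) / 3) := by
  refine ⟨202, by norm_num, fun n hn => ?_⟩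
  obtain ⟨D, _, _, c, u, hu, hc, hcard, hD⟩ := exists_hypercube_partition (n := n) (by omega)
  have hn2 : (2 : ℝ) ≤ n := by exact_mod_cast hn
  have hn0 : (0 : ℝ) < n := by linarith
  have hlog : 0 < Real.log n := Real.log_pos (by linarith)
  have hDne : Nonempty D := ⟨c fun _ => false⟩
  have hM : 0 < Fintype.card D * Real.log n :=
    mul_pos (by exact_mod_cast Fintype.card_pos) hlog
  set M := Fintype.card D * Real.log n with hMdef
  refine ⟨⌈M⌉₊, fun T hT => ?_⟩
  obtain ⟨η, γ, hη, hγ0, hγ1, hbound⟩ := exists_tuned_parameters hM (Nat.ceil_le.1 hT)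
  obtain ⟨π, hπ⟩ := exists_policy_regret_le
    (fun x y : Fin n → Bool => decide ((Finset.univ.filter fun i => x i ≠ y i).card = 1))
    (fun v => by simpa using hu v) hc hn2 (fun B => by exact_mod_cast hcard B) hη hγ0 hγ1
  have hMle : M ≤ 8 * ((2 : ℝ) ^ n / n * Real.log n) := by
    have h1 : (Fintype.card D : ℝ) * n ≤ 2 * 2 ^ n := by exact_mod_cast hD
    have h2 : (Fintype.card D : ℝ) ≤ 2 * 2 ^ n / n := (le_div_iff₀ hn0).2 h1
    have h3 : 0 ≤ (2 : ℝ) ^ n / n * Real.log n := by positivity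
    calc M ≤ 2 * 2 ^ n / n * Real.log n := mul_le_mul_of_nonneg_right h2 hlog.le
      _ = 2 * ((2 : ℝ) ^ n / n * Real.log n) := by ring
      _ ≤ _ := by linarith
  have hroot : M ^ ((1 : ℝ) / 3) ≤ 2 * ((2 : ℝ) ^ n / n * Real.log n) ^ ((1 : ℝ) / 3) := by
    have h8 : (8 : ℝ) ^ ((1 : ℝ) / 3) = 2 := by
      rw [show (8 : ℝ) = 2 ^ (3 : ℝ) by norm_num, ← Real.rpow_mul (by norm_num)]
      norm_num
    refine (Real.rpow_le_rpow hM.le hMle (by norm_num)).trans_eq ?_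
    rw [Real.mul_rpow (by norm_num) (by positivity), h8]
  refine minimaxRegret_le_of_policy (by positivity) π fun ℓ hℓ => ?_
  refine ((hπ ℓ hℓ T).trans hbound).trans ?_
  have hT2 : (0 : ℝ) ≤ (T : ℝ) ^ ((2 : ℝ) / 3) := by positivity
  linarith [mul_le_mul_of_nonneg_right hroot hT2]
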